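/- arXiv:2305.11069 — 9 statements merged into one kernel-verified Lean document; each statement's English description precedes it below -/
import Mathlib

section
/- For every real μ, one has 9μ²(μ²−4)+4 < 0 if and only if (2/3)(3 − 2√2) < μ² < (2/3)(3 + 2√2). Moreover, if μ² lies in this open interval, then for every κ ≥ 0 one has F_n(κ,μ,1) > 0; in particular the negative homothety flow admits no static solution for any nonnegative κ in this range of μ. -/
/-- The negative homothety flow function
`F_n(κ,μ,y) = 2(κ/9 + 1/3)y − κ/3 + μ²/y + κμ²/y² − κμ⁴/(4y⁴)`. -/
noncomputable def Fn (κ μ y : ℝ) : ℝ :=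
  2 * (κ / 9 + 1 / 3) * y - κ / 3 + μ ^ 2 / y + κ * μ ^ 2 / y ^ 2 - κ * μ ^ 4 / (4 * y ^ 4)

/-- `9μ²(μ²−4)+4 < 0` iff `(2/3)(3 − 2√2) < μ² < (2/3)(3 + 2√2)`, and in this range of `μ`
the negative homothety flow has `F_n(κ,μ,1) > 0` for every `κ ≥ 0`, hence no static solution. -/
theorem negative_homothety_no_static (μ : ℝ) :
    (9 * μ ^ 2 * (μ ^ 2 - 4) + 4 < 0 ↔
      2 / 3 * (3 - 2 * Real.sqrt 2) < μ ^ 2 ∧ μ ^ 2 < 2 / 3 * (3 + 2 * Real.sqrt 2)) ∧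
    ((2 / 3 * (3 - 2 * Real.sqrt 2) < μ ^ 2 ∧ μ ^ 2 < 2 / 3 * (3 + 2 * Real.sqrt 2)) →
      ∀ κ : ℝ, 0 ≤ κ → 0 < Fn κ μ 1) := by
  have quadratic_neg_iff : 9 * μ ^ 2 * (μ ^ 2 - 4) + 4 < 0 ↔
      2 / 3 * (3 - 2 * Real.sqrt 2) < μ ^ 2 ∧ μ ^ 2 < 2 / 3 * (3 + 2 * Real.sqrt 2) := by
    have sq_sqrt_two : Real.sqrt 2 ^ 2 = 2 := Real.sq_sqrt (by norm_num)
    have complete_square : 9 * μ ^ 2 * (μ ^ 2 - 4) + 4 =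
        (3 * μ ^ 2 - 6) ^ 2 - (4 * Real.sqrt 2) ^ 2 := by
      linear_combination 16 * sq_sqrt_two
    rw [complete_square, sub_neg, sq_lt_sq, abs_of_nonneg (by positivity : 0 ≤ 4 * Real.sqrt 2),
      abs_lt]
    constructor <;> rintro ⟨h₁, h₂⟩ <;> constructor <;> linarith
  refine ⟨quadratic_neg_iff, fun h κ hκ => ?_⟩
  have Fn_one : Fn κ μ 1 =
      2 / 3 + μ ^ 2 + κ * -(9 * μ ^ 2 * (μ ^ 2 - 4) + 4) / 36 := by
    unfold Fn
    ring
  have coeff_pos : 0 < -(9 * μ ^ 2 * (μ ^ 2 - 4) + 4) := neg_pos.mpr (quadratic_neg_iff.mpr h)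
  rw [Fn_one]
  positivity
end

section
/- Let μ, κ be real numbers with μ² > 2/3 and 0 < κ < (36μ² − 24)/(9μ²(μ²+4)+4). Then F_p(κ,μ,1) > 0, and there exist y₁ ∈ (0,1) and y₂ ∈ (1,∞) such that F_p(κ,μ,y₁) = 0 and F_p(κ,μ,y₂) = 0. (These two zeros bracket σ = 1 and force every positive homothety flow starting at σ₀ = 1 to be eternal and regular.) -/
/-- The positive homothety flow function
`F_p(κ,μ,y) = 2(κ/9 − 1/3)y − κ/3 + μ²/y − κμ²/y² − κμ⁴/(4y⁴)`. -/
noncomputable def Fp (κ μ y : ℝ) : ℝ :=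
  2 * (κ / 9 - 1 / 3) * y - κ / 3 + μ ^ 2 / y - κ * μ ^ 2 / y ^ 2 - κ * μ ^ 4 / (4 * y ^ 4)

theorem Fp_one_pos {κ μ : ℝ}
    (hκ : κ < (36 * μ ^ 2 - 24) / (9 * μ ^ 2 * (μ ^ 2 + 4) + 4)) : 0 < Fp κ μ 1 := by
  rw [lt_div_iff₀ (by positivity)] at hκ
  unfold Fp
  linarith

theorem lt_one_of_lt_kappa_crit {κ μ : ℝ}
    (hκ : κ < (36 * μ ^ 2 - 24) / (9 * μ ^ 2 * (μ ^ 2 + 4) + 4)) : κ < 1 := by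
  refine hκ.trans ?_
  rw [div_lt_one (by positivity)]
  nlinarith [sq_nonneg (μ ^ 2)]

theorem continuousOn_Fp (κ μ : ℝ) : ContinuousOn (Fp κ μ) (Set.Ioi 0) := by
  unfold Fp
  fun_prop (disch := intro y hy; have : (0 : ℝ) < y := hy; positivity)

theorem Fp_neg_of_lt {κ μ y : ℝ} (hκ0 : 0 < κ) (hκ1 : κ < 1) (hμ : 0 < μ ^ 2)
    (hy0 : 0 < y) (hy1 : y < 1) (hy : 4 * y < κ * μ ^ 2) : Fp κ μ y < 0 := by
  have hcube : y ^ 3 ≤ y := pow_le_of_le_one hy0.le hy1.le (by norm_num)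
  have hquartic : μ ^ 2 / y < κ * μ ^ 4 / (4 * y ^ 4) := by
    rw [div_lt_div_iff₀ hy0 (by positivity)]
    have : 0 < y * μ ^ 2 * (κ * μ ^ 2 - 4 * y ^ 3) := by
      apply mul_pos (by positivity)
      linarith
    linarith
  have hlinear : 2 * (κ / 9 - 1 / 3) * y < 0 := mul_neg_of_neg_of_pos (by linarith) hy0
  have hsquare : 0 ≤ κ * μ ^ 2 / y ^ 2 := by positivity
  unfold Fp
  linarith

theorem Fp_neg_of_gt {κ μ y : ℝ} (hκ0 : 0 < κ) (hκ1 : κ < 1) (hy0 : 0 < y)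
    (hy : 9 * μ ^ 2 < 4 * y ^ 2) : Fp κ μ y < 0 := by
  have hinv : μ ^ 2 / y < 4 / 9 * y := by
    rw [div_lt_iff₀ hy0]
    linarith
  have hlinear : 2 * (κ / 9 - 1 / 3) * y ≤ -(4 / 9) * y :=
    mul_le_mul_of_nonneg_right (by linarith) hy0.le
  have hsquare : 0 ≤ κ * μ ^ 2 / y ^ 2 := by positivity
  have hquartic : 0 ≤ κ * μ ^ 4 / (4 * y ^ 4) := by positivity
  unfold Fp
  linarith

/-- For `μ² > 2/3` and `0 < κ < κ_crit^p(μ)`, one has `F_p(κ,μ,1) > 0` and there are zeros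
`y₁ ∈ (0,1)` and `y₂ ∈ (1,∞)` of `F_p(κ,μ,·)`. -/
theorem positive_homothety_eternal (κ μ : ℝ) (hμ : 2 / 3 < μ ^ 2) (hκ0 : 0 < κ)
    (hκ : κ < (36 * μ ^ 2 - 24) / (9 * μ ^ 2 * (μ ^ 2 + 4) + 4)) :
    0 < Fp κ μ 1 ∧
    (∃ y₁ ∈ Set.Ioo (0 : ℝ) 1, Fp κ μ y₁ = 0) ∧
    (∃ y₂ ∈ Set.Ioi (1 : ℝ), Fp κ μ y₂ = 0) := by
  have hμ0 : 0 < μ ^ 2 := by linarith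
  have hκ1 := lt_one_of_lt_kappa_crit hκ
  have hone := Fp_one_pos hκ
  refine ⟨hone, ?_, ?_⟩
  · have hpos : 0 < κ * μ ^ 2 := by positivity
    obtain ⟨a, ha0, ha⟩ := exists_between (lt_min one_pos (div_pos hpos four_pos))
    obtain ⟨ha1, ha⟩ := lt_min_iff.1 ha
    have hneg := Fp_neg_of_lt hκ0 hκ1 hμ0 ha0 ha1 (by linarith)
    obtain ⟨y, hy, hFy⟩ := intermediate_value_Ioo ha1.le
      ((continuousOn_Fp κ μ).mono fun x hx => ha0.trans_le hx.1) ⟨hneg, hone⟩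
    exact ⟨y, ⟨ha0.trans hy.1, hy.2⟩, hFy⟩
  · have hb : 1 ≤ 1 + 3 * μ ^ 2 := by linarith
    have hneg := Fp_neg_of_gt hκ0 hκ1 (one_pos.trans_le hb)
      (show 9 * μ ^ 2 < 4 * (1 + 3 * μ ^ 2) ^ 2 by nlinarith [sq_nonneg (μ ^ 2)])
    obtain ⟨y, hy, hFy⟩ := intermediate_value_Ioo' hb
      ((continuousOn_Fp κ μ).mono fun x hx => one_pos.trans_le hx.1) ⟨hneg, hone⟩
    exact ⟨y, hy.1, hFy⟩
end

section
/- Let μ, κ be real numbers with 0 < μ² < (2/3)(3 − 2√2) and κ > (36μ² + 24)/(9μ²(μ²−4)+4) (note that 9μ²(μ²−4)+4 > 0 in this range of μ). Then F_n(κ,μ,1) < 0, and there exist y₁ ∈ (0,1) and y₂ ∈ (1,∞) such that F_n(κ,μ,y₁) = 0 and F_n(κ,μ,y₂) = 0. (These zeros bracket σ = 1 and yield eternal, regular negative homothety flows.) -/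
lemma continuousOn_Fn (κ μ : ℝ) {s : Set ℝ} (hs : ∀ y ∈ s, 0 < y) :
    ContinuousOn (Fn κ μ) s := by
  have hne : ∀ y ∈ s, y ≠ 0 := fun y hy => (hs y hy).ne'
  unfold Fn
  fun_prop (disch := intro y hy; have := hne y hy; positivity)

lemma Fn_abs_pos {κ μ : ℝ} (hκ : 0 < κ) (hμ : μ ≠ 0) : 0 < Fn κ μ |μ| := by
  have hpos : 0 < |μ| := abs_pos.mpr hμ
  have h : Fn κ μ |μ| = κ * (2 / 9 * |μ| + 5 / 12) + 5 / 3 * |μ| := by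
    have h4 : μ ^ 4 = |μ| ^ 4 := (Even.pow_abs (by decide) μ).symm
    rw [Fn, ← sq_abs μ, h4]
    field_simp
    ring
  rw [h]
  positivity

lemma Fn_two_pos {κ μ : ℝ} (hκ : 0 < κ) (hμ : μ ^ 2 ≤ 1) : 0 < Fn κ μ 2 := by
  have h : Fn κ μ 2 =
      κ * (1 / 9 + μ ^ 2 * (15 / 64 + (1 - μ ^ 2) / 64)) + (4 / 3 + μ ^ 2 / 2) := by
    rw [Fn]
    ring
  have h1 : 0 ≤ 1 - μ ^ 2 := sub_nonneg.mpr hμ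
  rw [h]
  positivity

/-- For `0 < μ² < (2/3)(3 − 2√2)` and `κ > κ_crit^n(μ)` (the denominator `9μ²(μ²−4)+4` being
positive in this range), one has `F_n(κ,μ,1) < 0` and there are zeros `y₁ ∈ (0,1)` and
`y₂ ∈ (1,∞)` of `F_n(κ,μ,·)`. -/
theorem negative_homothety_eternal_regular (κ μ : ℝ)
    (hμ0 : 0 < μ ^ 2) (hμ : μ ^ 2 < 2 / 3 * (3 - 2 * Real.sqrt 2))
    (hκ : κ > (36 * μ ^ 2 + 24) / (9 * μ ^ 2 * (μ ^ 2 - 4) + 4)) :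
    Fn κ μ 1 < 0 ∧
    (∃ y₁ ∈ Set.Ioo (0 : ℝ) 1, Fn κ μ y₁ = 0) ∧
    (∃ y₂ ∈ Set.Ioi (1 : ℝ), Fn κ μ y₂ = 0) := by
  have h2 : Real.sqrt 2 ^ 2 = 2 := Real.sq_sqrt (by norm_num)
  have h2' : 1 < Real.sqrt 2 := by
    rw [Real.lt_sqrt] <;> norm_num
  have hμ1 : μ ^ 2 < 1 := by linarith
  have hden : 0 < 9 * μ ^ 2 * (μ ^ 2 - 4) + 4 := by
    have hroots : 0 < (2 / 3 * (3 - 2 * Real.sqrt 2) - μ ^ 2) *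
        (2 / 3 * (3 + 2 * Real.sqrt 2) - μ ^ 2) :=
      mul_pos (by linarith) (by linarith)
    nlinarith
  have hκ0 : 0 < κ := lt_trans (by positivity) hκ
  have hone : Fn κ μ 1 < 0 := by
    have hcrit := (div_lt_iff₀ hden).mp hκ
    rw [Fn]
    linarith
  have hμne : μ ≠ 0 := by
    rintro rfl
    simp at hμ0
  have habs : 0 < |μ| := abs_pos.mpr hμne
  have habs1 : |μ| ≤ 1 := ((sq_lt_one_iff_abs_lt_one μ).mp hμ1).le
  refine ⟨hone, ?_, ?_⟩
  · obtain ⟨y, hy, hy0⟩ := intermediate_value_Ioo' habs1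
      (continuousOn_Fn κ μ fun y hy => habs.trans_le hy.1) ⟨hone, Fn_abs_pos hκ0 hμne⟩
    exact ⟨y, ⟨habs.trans hy.1, hy.2⟩, hy0⟩
  · obtain ⟨y, hy, hy0⟩ := intermediate_value_Ioo one_le_two
      (continuousOn_Fn κ μ fun y hy => one_pos.trans_le hy.1) ⟨hone, Fn_two_pos hκ0 hμ1.le⟩
    exact ⟨y, hy.1, hy0⟩
end

section
/- Let μ, κ be real numbers with 0 < μ² < (2/3)(3 − 2√2) and 0 < κ < (36μ² + 24)/(9μ²(μ²−4)+4). Then F_n(κ,μ,1) > 0, the function y ↦ F_n(κ,μ,y) tends to +∞ as y → +∞, and there exists y₀ ∈ (0,1) with F_n(κ,μ,y₀) = 0. -/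
/-- Clearing denominators at `y = 1` exhibits the sign of `Fn κ μ 1`. -/
theorem Fn_one (κ μ : ℝ) :
    Fn κ μ 1 = (36 * μ ^ 2 + 24 - κ * (9 * μ ^ 2 * (μ ^ 2 - 4) + 4)) / 36 := by
  unfold Fn
  ring

/-- The denominator of the critical value is positive below the smaller root. -/
theorem critical_denominator_pos {m : ℝ} (hm : m < 2 / 3 * (3 - 2 * Real.sqrt 2)) :
    0 < 9 * m * (m - 4) + 4 := by
  have hsq : Real.sqrt 2 ^ 2 = 2 := Real.sq_sqrt (by norm_num)
  nlinarith [Real.sqrt_nonneg 2]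

theorem tendsto_Fn_atTop {κ : ℝ} (hκ : 0 < κ) (μ : ℝ) :
    Filter.Tendsto (fun y => Fn κ μ y) Filter.atTop Filter.atTop := by
  have hlin : Filter.Tendsto
      (fun y : ℝ => 2 * (κ / 9 + 1 / 3) * y + (-(κ / 3) - κ * μ ^ 4 / 4))
      Filter.atTop Filter.atTop :=
    Filter.tendsto_atTop_add_const_right _ _
      (Filter.tendsto_id.const_mul_atTop (by positivity))
  refine Filter.tendsto_atTop_mono' _ ?_ hlin
  filter_upwards [Filter.eventually_ge_atTop (1 : ℝ)] with y hy
  have hquartic : κ * μ ^ 4 / (4 * y ^ 4) ≤ κ * μ ^ 4 / 4 := by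
    have hy4 : 1 ≤ y ^ 4 := one_le_pow₀ hy
    exact div_le_div_of_nonneg_left (by positivity) (by norm_num) (by linarith)
  have hinv : 0 ≤ μ ^ 2 / y := by positivity
  have hinvsq : 0 ≤ κ * μ ^ 2 / y ^ 2 := by positivity
  unfold Fn
  linarith

/-- Multiplying by `y ^ 4` gives a polynomial that is negative at `0`. -/
theorem exists_Fn_eq_zero {κ μ : ℝ} (hκ : 0 < κ) (hμ : 0 < μ ^ 2) (hone : 0 < Fn κ μ 1) :
    ∃ y₀ ∈ Set.Ioo (0 : ℝ) 1, Fn κ μ y₀ = 0 := by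
  let P : ℝ → ℝ := fun y =>
    2 * (κ / 9 + 1 / 3) * y ^ 5 - κ / 3 * y ^ 4 + μ ^ 2 * y ^ 3 + κ * μ ^ 2 * y ^ 2 - κ * μ ^ 4 / 4
  have hP : ContinuousOn P (Set.Icc 0 1) := by fun_prop
  have hP0 : P 0 < 0 := by
    have : 0 < κ * (μ ^ 2) ^ 2 := by positivity
    simp only [P]
    linarith
  have hP1 : 0 < P 1 := by
    unfold Fn at hone
    simp only [P]
    linarith
  obtain ⟨y, hy, hy0⟩ := intermediate_value_Ioo zero_le_one hP ⟨hP0, hP1⟩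
  refine ⟨y, hy, ?_⟩
  have hy_ne : y ≠ 0 := hy.1.ne'
  have hmul : Fn κ μ y = P y / y ^ 4 := by
    simp only [Fn, P]
    field_simp
  rw [hmul, hy0, zero_div]

/-- For `0 < μ² < (2/3)(3 − 2√2)` and `0 < κ < κ_crit^n(μ)`, one has `F_n(κ,μ,1) > 0`,
`F_n(κ,μ,y) → +∞` as `y → +∞`, and there is a zero `y₀ ∈ (0,1)` of `F_n(κ,μ,·)`. -/
theorem negative_homothety_subcritical (κ μ : ℝ)
    (hμ0 : 0 < μ ^ 2) (hμ : μ ^ 2 < 2 / 3 * (3 - 2 * Real.sqrt 2))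
    (hκ0 : 0 < κ) (hκ : κ < (36 * μ ^ 2 + 24) / (9 * μ ^ 2 * (μ ^ 2 - 4) + 4)) :
    0 < Fn κ μ 1 ∧
    Filter.Tendsto (fun y => Fn κ μ y) Filter.atTop Filter.atTop ∧
    (∃ y₀ ∈ Set.Ioo (0 : ℝ) 1, Fn κ μ y₀ = 0) := by
  have hone : 0 < Fn κ μ 1 := by
    rw [lt_div_iff₀ (critical_denominator_pos hμ)] at hκ
    rw [Fn_one]
    linarith
  exact ⟨hone, tendsto_Fn_atTop hκ0 μ, exists_Fn_eq_zero hκ0 hμ0 hone⟩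
end

section
/- Let κ > 0 and μ ≠ 0 be real with a := κμ²/4 < 1. Define Φ : (a, ∞) → ℝ by Φ(u) = u + a·log((u − a)/(1 − a)). Then Φ is a strictly increasing bijection from (a, ∞) onto ℝ, and the function σ(t) := (Φ⁻¹(3μ²t + 1))^{1/3}, defined for all t ∈ ℝ, satisfies σ(0) = 1, is differentiable with σ(t)·σ'(t) = μ²/σ(t) − κμ⁴/(4σ(t)⁴) at every t ∈ ℝ, and has the asymptotics σ(t) → (κμ²/4)^{1/3} as t → −∞ and σ(t) → +∞ as t → +∞. (Eternal solutions of the flat homothety flow for b := 4/(κμ²) − 1 > 0.) -/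
open Set Filter Topology

section LinearAddLog

variable {a c : ℝ}

/-- The profile `u ↦ u + a·log((u − a)/c)` is strictly increasing on `(a, ∞)`. -/
theorem strictMonoOn_add_mul_log (ha : 0 < a) (hc : 0 < c) :
    StrictMonoOn (fun u => u + a * Real.log ((u - a) / c)) (Ioi a) := by
  intro x hx y _ hxy
  have hxa : 0 < x - a := sub_pos.2 hx
  have hlog : Real.log ((x - a) / c) < Real.log ((y - a) / c) :=
    Real.log_lt_log (by positivity) (by gcongr)
  have := mul_lt_mul_of_pos_left hlog ha
  simp only
  linarith

theorem hasDerivAt_add_mul_log (hc : 0 < c) {u : ℝ} (hu : a < u) :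
    HasDerivAt (fun u => u + a * Real.log ((u - a) / c)) (1 + a / (u - a)) u := by
  have hua : u - a ≠ 0 := (sub_pos.2 hu).ne'
  have hlog := ((((hasDerivAt_id u).sub_const a).div_const c).log
    (div_ne_zero hua hc.ne')).const_mul a
  refine ((hasDerivAt_id u).add hlog).congr_deriv ?_
  simp only [id]
  field_simp

theorem surjOn_add_mul_log (ha : 0 < a) (hc : 0 < c) :
    SurjOn (fun u => u + a * Real.log ((u - a) / c)) (Ioi a) univ := by
  have hcont : ContinuousOn (fun u => u + a * Real.log ((u - a) / c)) (Ioi a) :=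
    fun u hu => (hasDerivAt_add_mul_log hc hu).continuousAt.continuousWithinAt
  have hbot : Tendsto (fun u => u + a * Real.log ((u - a) / c)) (𝓝[>] a) atBot := by
    have harg : Tendsto (fun u => (u - a) / c) (𝓝[>] a) (𝓝[>] 0) := by
      refine tendsto_nhdsWithin_iff.2 ⟨?_, ?_⟩
      · have hca : Continuous fun u : ℝ => (u - a) / c := by fun_prop
        simpa using (hca.tendsto a).mono_left nhdsWithin_le_nhds
      · filter_upwards [self_mem_nhdsWithin] with u hu
        exact div_pos (sub_pos.2 hu) hc
    exact Tendsto.add_atBot (tendsto_id.mono_left nhdsWithin_le_nhds)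
      ((Real.tendsto_log_nhdsGT_zero.comp harg).const_mul_atBot ha)
  have htop : Tendsto (fun u => u + a * Real.log ((u - a) / c)) atTop atTop := by
    have harg : Tendsto (fun u => (u - a) / c) atTop atTop :=
      (tendsto_atTop_add_const_right _ (-a) tendsto_id).atTop_div_const hc
    exact tendsto_id.atTop_add_atTop ((Real.tendsto_log_atTop.comp harg).const_mul_atTop ha)
  exact isPreconnected_Ioi.intermediate_value_Iii (l₁ := 𝓝[>] a) (l₂ := atTop)
    (le_principal_iff.2 self_mem_nhdsWithin) (le_principal_iff.2 (Ioi_mem_atTop a))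
    hcont hbot htop

end LinearAddLog

section InvFunOn

variable {f : ℝ → ℝ} {a : ℝ}

theorem StrictMonoOn.strictMono_invFunOn (hf : StrictMonoOn f (Ioi a))
    (hs : SurjOn f (Ioi a) univ) : StrictMono (Function.invFunOn f (Ioi a)) := by
  intro x y hxy
  have hx := hs (mem_univ x)
  have hy := hs (mem_univ y)
  rw [← hf.lt_iff_lt (Function.invFunOn_mem hx) (Function.invFunOn_mem hy),
    Function.invFunOn_eq hx, Function.invFunOn_eq hy]
  exact hxy

theorem StrictMonoOn.range_invFunOn (hf : StrictMonoOn f (Ioi a))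
    (hs : SurjOn f (Ioi a) univ) : range (Function.invFunOn f (Ioi a)) = Ioi a := by
  ext u
  constructor
  · rintro ⟨y, rfl⟩
    exact Function.invFunOn_mem (hs (mem_univ y))
  · exact fun hu => ⟨f u, hf.injOn.leftInvOn_invFunOn hu⟩

theorem StrictMonoOn.continuous_invFunOn (hf : StrictMonoOn f (Ioi a))
    (hs : SurjOn f (Ioi a) univ) : Continuous (Function.invFunOn f (Ioi a)) := by
  refine continuous_iff_continuousAt.2 fun y => ?_
  refine ((hf.strictMono_invFunOn hs).strictMonoOn univ).continuousAt_of_image_mem_nhds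
    univ_mem ?_
  rw [image_univ, hf.range_invFunOn hs]
  exact Ioi_mem_nhds (Function.invFunOn_mem (hs (mem_univ y)))

theorem StrictMonoOn.tendsto_invFunOn_atBot (hf : StrictMonoOn f (Ioi a))
    (hs : SurjOn f (Ioi a) univ) : Tendsto (Function.invFunOn f (Ioi a)) atBot (𝓝 a) := by
  refine tendsto_atBot_isGLB (hf.strictMono_invFunOn hs).monotone ?_
  rw [hf.range_invFunOn hs]
  exact isGLB_Ioi

theorem StrictMonoOn.tendsto_invFunOn_atTop (hf : StrictMonoOn f (Ioi a))
    (hs : SurjOn f (Ioi a) univ) : Tendsto (Function.invFunOn f (Ioi a)) atTop atTop := by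
  refine tendsto_atTop_atTop_of_monotone (hf.strictMono_invFunOn hs).monotone fun b => ?_
  have hmem : max b (a + 1) ∈ Ioi a := lt_of_lt_of_le (lt_add_one a) (le_max_right _ _)
  rw [← hf.range_invFunOn hs] at hmem
  obtain ⟨y, hy⟩ := hmem
  exact ⟨y, hy ▸ le_max_left _ _⟩

end InvFunOn

/-- Eternal solutions of the flat homothety Heterotic-Ricci flow for `b = 4/(κμ²) − 1 > 0`,
i.e. `a := κμ²/4 < 1`: the function `Φ(u) = u + a·log((u−a)/(1−a))` is a strictly increasing
bijection from `(a,∞)` onto `ℝ`, and `σ(t) = (Φ⁻¹(3μ²t+1))^{1/3}` satisfies `σ(0) = 1`, solves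
`σ·σ' = μ²/σ − κμ⁴/(4σ⁴)` on all of `ℝ`, tends to `(κμ²/4)^{1/3}` as `t → −∞` and to `+∞`
as `t → +∞`. -/
theorem flat_homothety_flow_eternal (κ μ : ℝ) (hκ : 0 < κ) (hμ : μ ≠ 0)
    (ha : κ * μ ^ 2 / 4 < 1) (Φ σ : ℝ → ℝ)
    (hΦ : Φ = fun u => u +
      (κ * μ ^ 2 / 4) * Real.log ((u - κ * μ ^ 2 / 4) / (1 - κ * μ ^ 2 / 4)))
    (hσ : σ = fun t =>
      (Function.invFunOn Φ (Set.Ioi (κ * μ ^ 2 / 4)) (3 * μ ^ 2 * t + 1)) ^ ((1 : ℝ) / 3)) :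
    StrictMonoOn Φ (Set.Ioi (κ * μ ^ 2 / 4)) ∧
    Set.BijOn Φ (Set.Ioi (κ * μ ^ 2 / 4)) Set.univ ∧
    σ 0 = 1 ∧
    (∀ t : ℝ, ∃ d : ℝ, HasDerivAt σ d t ∧
      σ t * d = μ ^ 2 / σ t - κ * μ ^ 4 / (4 * (σ t) ^ 4)) ∧
    Filter.Tendsto σ Filter.atBot (nhds ((κ * μ ^ 2 / 4) ^ ((1 : ℝ) / 3))) ∧
    Filter.Tendsto σ Filter.atTop Filter.atTop := by
  have hμ2 : 0 < μ ^ 2 := by positivity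
  have hκμ : κ * μ ^ 4 = 4 * (κ * μ ^ 2 / 4) * μ ^ 2 := by ring
  rw [hκμ]
  have ha0 : 0 < κ * μ ^ 2 / 4 := by positivity
  generalize κ * μ ^ 2 / 4 = a at *
  have hc : 0 < 1 - a := sub_pos.2 ha
  have hmono : StrictMonoOn Φ (Ioi a) := hΦ ▸ strictMonoOn_add_mul_log ha0 hc
  have hsurj : SurjOn Φ (Ioi a) univ := hΦ ▸ surjOn_add_mul_log ha0 hc
  have hderiv : ∀ u, a < u → HasDerivAt Φ (1 + a / (u - a)) u :=
    fun u hu => hΦ ▸ hasDerivAt_add_mul_log hc hu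
  have hmem : ∀ y, a < Function.invFunOn Φ (Ioi a) y :=
    fun y => Function.invFunOn_mem (hsurj (mem_univ y))
  have heq : ∀ y, Φ (Function.invFunOn Φ (Ioi a) y) = y :=
    fun y => Function.invFunOn_eq (hsurj (mem_univ y))
  have hcont := hmono.continuous_invFunOn hsurj
  have hbot := hmono.tendsto_invFunOn_atBot hsurj
  have htop := hmono.tendsto_invFunOn_atTop hsurj
  have hone : Function.invFunOn Φ (Ioi a) 1 = 1 := by
    have hΦ1 : Φ 1 = 1 := by simp [hΦ, div_self hc.ne']
    simpa only [hΦ1] using hmono.injOn.leftInvOn_invFunOn (show (1 : ℝ) ∈ Ioi a from ha)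
  generalize Function.invFunOn Φ (Ioi a) = g at *
  subst hσ
  refine ⟨hmono, ⟨mapsTo_univ _ _, hmono.injOn, hsurj⟩, by simp [hone], fun t => ?_, ?_, ?_⟩
  · have hlin : HasDerivAt (fun t : ℝ => 3 * μ ^ 2 * t + 1) (3 * μ ^ 2) t := by
      simpa using ((hasDerivAt_id t).const_mul (3 * μ ^ 2)).add_const 1
    have hga : 0 < g (3 * μ ^ 2 * t + 1) - a := sub_pos.2 (hmem _)
    have hgpos : 0 < g (3 * μ ^ 2 * t + 1) := ha0.trans (hmem _)
    have hg := (hderiv _ (hmem (3 * μ ^ 2 * t + 1))).of_local_left_inverse hcont.continuousAt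
      (by positivity) (Eventually.of_forall heq)
    refine ⟨_, (hg.comp t hlin).rpow_const (p := (1 : ℝ) / 3) (Or.inl hgpos.ne'), ?_⟩
    simp only [Function.comp_apply]
    generalize g (3 * μ ^ 2 * t + 1) = u at *
    have hs : 0 < u ^ ((1 : ℝ) / 3) := Real.rpow_pos_of_pos hgpos _
    have hcube : (u ^ ((1 : ℝ) / 3)) ^ 3 = u := by
      rw [← Real.rpow_natCast, ← Real.rpow_mul hgpos.le]
      norm_num
    rw [Real.rpow_sub_one hgpos.ne']
    generalize u ^ ((1 : ℝ) / 3) = s at *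
    subst hcube
    have hsum : 1 + a / (s ^ 3 - a) = s ^ 3 / (s ^ 3 - a) := by
      field_simp
      ring
    rw [hsum]
    field_simp
  · have hlin : Tendsto (fun t : ℝ => 3 * μ ^ 2 * t + 1) atBot atBot :=
      tendsto_atBot_add_const_right _ 1 (tendsto_id.const_mul_atBot (by positivity))
    exact (hbot.comp hlin).rpow_const (Or.inl ha0.ne')
  · have hlin : Tendsto (fun t : ℝ => 3 * μ ^ 2 * t + 1) atTop atTop :=
      tendsto_atTop_add_const_right _ 1 (tendsto_id.const_mul_atTop (by positivity))
    exact (tendsto_rpow_atTop (by norm_num)).comp (htop.comp hlin)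
end

section
/- Let κ > 0. Define Φ : (0,3) → ℝ by Φ(x) = x + 3·log(3 − x). Then Φ is strictly decreasing and is a bijection from (0,3) onto (−∞, 3·log 3). Setting t_max := (κ/4)·(log(27/8) − 1), the function σ(t) := Φ⁻¹(4t/κ + 1 + 3·log 2), defined for t ∈ (−∞, t_max), takes values in (0,3), is differentiable with σ'(t) = 4(σ(t) − 3)/(κ·σ(t)) at every t < t_max (equivalently σ·σ' = (4σ − 12)/κ), and satisfies σ(t) → 3 as t → −∞ and σ(t) → 0 as t → t_max from the left. -/
open Set Filter Topology

/-- The first integral `x + 3 * log (3 - x)` of the homothety flow. -/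
noncomputable def flowPotential (x : ℝ) : ℝ := x + 3 * Real.log (3 - x)

/-- The inverse of `flowPotential` on the interval `(0, 3)`. -/
noncomputable def flowPotentialInv : ℝ → ℝ := Function.invFunOn flowPotential (Ioo 0 3)

theorem hasDerivAt_flowPotential {x : ℝ} (hx : x < 3) :
    HasDerivAt flowPotential (-x / (3 - x)) x := by
  have h3 : 3 - x ≠ 0 := by linarith
  have h := (hasDerivAt_id x).add
    ((((hasDerivAt_id x).const_sub 3).log (by simpa using h3)).const_mul 3)
  refine h.congr_deriv ?_
  simp only [id]
  field_simp
  ring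

theorem continuousOn_flowPotential : ContinuousOn flowPotential (Iio 3) := fun _ hx =>
  (hasDerivAt_flowPotential hx).continuousAt.continuousWithinAt

theorem strictAntiOn_flowPotential : StrictAntiOn flowPotential (Ico 0 3) := by
  refine strictAntiOn_of_deriv_neg (convex_Ico 0 3)
    (continuousOn_flowPotential.mono fun x hx => hx.2) fun x hx => ?_
  rw [interior_Ico] at hx
  rw [(hasDerivAt_flowPotential hx.2).deriv]
  exact div_neg_of_neg_of_pos (neg_neg_of_pos hx.1) (sub_pos.2 hx.2)

theorem bijOn_flowPotential :
    BijOn flowPotential (Ioo 0 3) (Iio (3 * Real.log 3)) := by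
  have h0 : flowPotential 0 = 3 * Real.log 3 := by simp [flowPotential]
  refine ⟨fun x hx => ?_, (strictAntiOn_flowPotential.mono Ioo_subset_Ico_self).injOn,
    fun y hy => ?_⟩
  · rw [← h0]
    exact strictAntiOn_flowPotential (by simp) (Ioo_subset_Ico_self hx) hx.1
  · have hy' : y < 3 * Real.log 3 := hy
    have hpos := Real.exp_pos ((y - 4) / 3)
    have hlt : Real.exp ((y - 4) / 3) < 3 := by
      rw [← Real.lt_log_iff_exp_lt (by norm_num)]
      linarith
    have hb : flowPotential (3 - Real.exp ((y - 4) / 3)) < y := by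
      simp only [flowPotential, sub_sub_cancel, Real.log_exp]
      linarith
    obtain ⟨x, hx, hxy⟩ := intermediate_value_Ioo' (f := flowPotential)
      (a := 0) (b := 3 - Real.exp ((y - 4) / 3)) (by linarith)
      (continuousOn_flowPotential.mono fun x hx => by
        have := hx.2
        simp only [mem_Iio]
        linarith) ⟨hb, by rwa [h0]⟩
    exact ⟨x, ⟨hx.1, by linarith [hx.2]⟩, hxy⟩

theorem flowPotentialInv_mem {y : ℝ} (hy : y < 3 * Real.log 3) :
    flowPotentialInv y ∈ Ioo (0 : ℝ) 3 :=
  Function.invFunOn_mem (bijOn_flowPotential.surjOn hy)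

theorem flowPotential_flowPotentialInv {y : ℝ} (hy : y < 3 * Real.log 3) :
    flowPotential (flowPotentialInv y) = y :=
  Function.invFunOn_eq (bijOn_flowPotential.surjOn hy)

theorem lt_flowPotentialInv_iff {a y : ℝ} (ha : a ∈ Ioo (0 : ℝ) 3) (hy : y < 3 * Real.log 3) :
    a < flowPotentialInv y ↔ y < flowPotential a := by
  conv_rhs => rw [← flowPotential_flowPotentialInv hy]
  exact (strictAntiOn_flowPotential.lt_iff_gt (Ioo_subset_Ico_self (flowPotentialInv_mem hy))
    (Ioo_subset_Ico_self ha)).symm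

theorem flowPotentialInv_lt_iff {a y : ℝ} (ha : a ∈ Ioo (0 : ℝ) 3) (hy : y < 3 * Real.log 3) :
    flowPotentialInv y < a ↔ flowPotential a < y := by
  conv_rhs => rw [← flowPotential_flowPotentialInv hy]
  exact (strictAntiOn_flowPotential.lt_iff_gt (Ioo_subset_Ico_self ha)
    (Ioo_subset_Ico_self (flowPotentialInv_mem hy))).symm

/-- Order criterion for limits of `flowPotentialInv`, at interior points and at both ends. -/
theorem tendsto_flowPotentialInv {l : Filter ℝ} {c : ℝ} (hc : c ∈ Icc (0 : ℝ) 3)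
    (hl : ∀ᶠ y in l, y < 3 * Real.log 3)
    (hlower : ∀ a ∈ Ioo (0 : ℝ) 3, a < c → ∀ᶠ y in l, y < flowPotential a)
    (hupper : ∀ a ∈ Ioo (0 : ℝ) 3, c < a → ∀ᶠ y in l, flowPotential a < y) :
    Tendsto flowPotentialInv l (𝓝 c) := by
  refine tendsto_order.2 ⟨fun a ha => ?_, fun a ha => ?_⟩
  · rcases le_or_gt a 0 with h | h
    · filter_upwards [hl] with y hy using h.trans_lt (flowPotentialInv_mem hy).1
    · have ha' : a ∈ Ioo (0 : ℝ) 3 := ⟨h, ha.trans_le hc.2⟩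
      filter_upwards [hl, hlower a ha' ha] with y hy hya
      exact (lt_flowPotentialInv_iff ha' hy).2 hya
  · rcases le_or_gt 3 a with h | h
    · filter_upwards [hl] with y hy using (flowPotentialInv_mem hy).2.trans_le h
    · have ha' : a ∈ Ioo (0 : ℝ) 3 := ⟨hc.1.trans_lt ha, h⟩
      filter_upwards [hl, hupper a ha' ha] with y hy hya
      exact (flowPotentialInv_lt_iff ha' hy).2 hya

theorem continuousAt_flowPotentialInv {y : ℝ} (hy : y < 3 * Real.log 3) :
    ContinuousAt flowPotentialInv y :=
  tendsto_flowPotentialInv (Ioo_subset_Icc_self (flowPotentialInv_mem hy)) (Iio_mem_nhds hy)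
    (fun _ ha h => Iio_mem_nhds ((lt_flowPotentialInv_iff ha hy).1 h))
    (fun _ ha h => Ioi_mem_nhds ((flowPotentialInv_lt_iff ha hy).1 h))

theorem hasDerivAt_flowPotentialInv {y : ℝ} (hy : y < 3 * Real.log 3) :
    HasDerivAt flowPotentialInv (-flowPotentialInv y / (3 - flowPotentialInv y))⁻¹ y := by
  have hmem := flowPotentialInv_mem hy
  refine (hasDerivAt_flowPotential hmem.2).of_local_left_inverse
    (continuousAt_flowPotentialInv hy)
    (div_ne_zero (neg_ne_zero.2 hmem.1.ne') (sub_pos.2 hmem.2).ne') ?_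
  filter_upwards [Iio_mem_nhds hy] with z hz using flowPotential_flowPotentialInv hz

theorem tendsto_flowPotentialInv_atBot : Tendsto flowPotentialInv atBot (𝓝 3) :=
  tendsto_flowPotentialInv (by norm_num) (eventually_lt_atBot _)
    (fun _ _ _ => eventually_lt_atBot _) (fun _ ha h => absurd ha.2 h.not_gt)

theorem tendsto_flowPotentialInv_nhdsLT :
    Tendsto flowPotentialInv (𝓝[<] (3 * Real.log 3)) (𝓝 0) :=
  tendsto_flowPotentialInv (by norm_num) self_mem_nhdsWithin
    (fun _ ha h => absurd ha.1 h.not_gt)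
    (fun _ ha _ => mem_nhdsWithin_of_mem_nhds
      (Ioi_mem_nhds (bijOn_flowPotential.mapsTo ha)))

theorem log_twentySeven_div_eight :
    Real.log (27 / 8) = 3 * Real.log 3 - 3 * Real.log 2 := by
  rw [show (27 / 8 : ℝ) = 3 ^ 3 / 2 ^ 3 by norm_num,
    Real.log_div (by norm_num) (by norm_num), Real.log_pow, Real.log_pow]
  norm_num

theorem flow_time_lt_iff {κ : ℝ} (hκ : 0 < κ) (t : ℝ) :
    4 * t / κ + 1 + 3 * Real.log 2 < 3 * Real.log 3 ↔
      t < κ / 4 * (Real.log (27 / 8) - 1) := by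
  rw [log_twentySeven_div_eight, add_assoc, ← lt_sub_iff_add_lt, div_lt_iff₀ hκ]
  constructor <;> intro h <;> linarith

/-- Explicit (Lambert-W-free) form of the homothety Heterotic-Ricci flow on `SU(2)`:
`Φ(x) = x + 3·log(3−x)` is strictly decreasing on `(0,3)` and a bijection onto
`(−∞, 3·log 3)`; with `t_max = (κ/4)(log(27/8) − 1)`, the function
`σ(t) = Φ⁻¹(4t/κ + 1 + 3·log 2)` takes values in `(0,3)` on `(−∞, t_max)`, satisfies
`σ' = 4(σ−3)/(κσ)` there, tends to `3` as `t → −∞` and to `0` as `t → t_max⁻`. -/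
theorem su2_homothety_flow (κ : ℝ) (hκ : 0 < κ) (Φ σ : ℝ → ℝ)
    (hΦ : Φ = fun x => x + 3 * Real.log (3 - x))
    (hσ : σ = fun t => Function.invFunOn Φ (Set.Ioo 0 3) (4 * t / κ + 1 + 3 * Real.log 2)) :
    StrictAntiOn Φ (Set.Ioo 0 3) ∧
    Set.BijOn Φ (Set.Ioo 0 3) (Set.Iio (3 * Real.log 3)) ∧
    (∀ t : ℝ, t < κ / 4 * (Real.log (27 / 8) - 1) →
      σ t ∈ Set.Ioo (0 : ℝ) 3 ∧ HasDerivAt σ (4 * (σ t - 3) / (κ * σ t)) t) ∧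
    Filter.Tendsto σ Filter.atBot (nhds 3) ∧
    Filter.Tendsto σ
      (nhdsWithin (κ / 4 * (Real.log (27 / 8) - 1))
        (Set.Iio (κ / 4 * (Real.log (27 / 8) - 1)))) (nhds 0) := by
  obtain rfl : Φ = flowPotential := hΦ
  have hσ' : σ = flowPotentialInv ∘ fun t => 4 * t / κ + 1 + 3 * Real.log 2 := hσ
  subst hσ'
  have htime (t : ℝ) : HasDerivAt (fun t => 4 * t / κ + 1 + 3 * Real.log 2) (4 / κ) t := by
    simpa using ((((hasDerivAt_id t).const_mul 4).div_const κ).add_const 1).add_const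
      (3 * Real.log 2)
  refine ⟨strictAntiOn_flowPotential.mono Ioo_subset_Ico_self, bijOn_flowPotential,
    fun t ht => ?_, ?_, ?_⟩
  · have hy := (flow_time_lt_iff hκ t).2 ht
    have hmem := flowPotentialInv_mem hy
    refine ⟨hmem, ?_⟩
    refine ((hasDerivAt_flowPotentialInv hy).comp t (htime t)).congr_deriv ?_
    simp only [Function.comp_apply]
    have h0 := hmem.1.ne'
    have h3 := (sub_pos.2 hmem.2).ne'
    generalize flowPotentialInv (4 * t / κ + 1 + 3 * Real.log 2) = s at h0 h3 ⊢
    field_simp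
    ring
  · refine tendsto_flowPotentialInv_atBot.comp ?_
    exact tendsto_atBot_add_const_right _ _ <| tendsto_atBot_add_const_right _ _ <|
      (tendsto_id.const_mul_atBot (by norm_num : (0 : ℝ) < 4)).atBot_div_const hκ
  · refine tendsto_flowPotentialInv_nhdsLT.comp (tendsto_nhdsWithin_iff.2 ⟨?_, ?_⟩)
    · have hend : 4 * (κ / 4 * (Real.log (27 / 8) - 1)) / κ + 1 + 3 * Real.log 2
          = 3 * Real.log 3 := by
        rw [log_twentySeven_div_eight]
        field_simp
        ring
      rw [← hend]
      exact (htime _).continuousAt.tendsto.mono_left nhdsWithin_le_nhds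
    · filter_upwards [self_mem_nhdsWithin] with t ht using (flow_time_lt_iff hκ t).2 ht
end

section
/- Let κ > 0 and f ≠ 0 be real numbers, and let μ₁, μ₂, μ₃ be real numbers such that μ₁ + μ₂ + μ₃ = −f²/2 and, for each i ∈ {1,2,3}, −κμᵢ² + (1 − κf²)μᵢ + f²/2 − κf⁴/4 = 0. Then exactly one of the following holds: (1) κf² = 1 and, up to a permutation, (μ₁, μ₂, μ₃) = (−1/(2κ), −1/(2κ), 1/(2κ)); (2) κf² = 2 and, up to a permutation, (μ₁, μ₂, μ₃) = (0, 0, −1/κ); (3) κf² = 3 and μ₁ = μ₂ = μ₃ = −1/(2κ). -/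
/-- The quadratic equation for a principal Ricci curvature has the two roots `-f²/2` and
`1/κ - f²/2`. -/
lemma principal_curvature_eq_or_eq {κ f μ : ℝ} (hκ : κ ≠ 0)
    (h : -κ * μ ^ 2 + (1 - κ * f ^ 2) * μ + f ^ 2 / 2 - κ * f ^ 4 / 4 = 0) :
    μ = -f ^ 2 / 2 ∨ μ = 1 / κ - f ^ 2 / 2 := by
  have hfactor : (μ + f ^ 2 / 2) * (κ * (μ + f ^ 2 / 2) - 1) = 0 := by linear_combination -h
  rcases mul_eq_zero.mp hfactor with h | h
  · left
    linear_combination h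
  · right
    field_simp
    linear_combination 2 * h

lemma Multiset.triple_swap_left {α : Type*} (a b c : α) :
    ({a, b, c} : Multiset α) = {b, a, c} :=
  Multiset.cons_swap a b {c}

lemma Multiset.triple_swap_right {α : Type*} (a b c : α) :
    ({a, b, c} : Multiset α) = {a, c, b} :=
  congrArg (Multiset.cons a) (Multiset.pair_comm b c)

/-- Algebraic core of the classification of three-dimensional Heterotic solitons with
constant dilaton: if the principal Ricci curvatures `μ₁, μ₂, μ₃` sum to `−f²/2` and each
satisfies `−κμᵢ² + (1 − κf²)μᵢ + f²/2 − κf⁴/4 = 0` (with `κ > 0`, `f ≠ 0`), then exactly one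
of the three listed cases holds.  (The three cases are mutually exclusive since their values
of `κf²` differ, so the disjunction below expresses "exactly one".) -/
theorem heterotic_soliton_constant_dilaton_classification
    (κ f μ₁ μ₂ μ₃ : ℝ) (hκ : 0 < κ) (hf : f ≠ 0)
    (hsum : μ₁ + μ₂ + μ₃ = -f ^ 2 / 2)
    (h1 : -κ * μ₁ ^ 2 + (1 - κ * f ^ 2) * μ₁ + f ^ 2 / 2 - κ * f ^ 4 / 4 = 0)
    (h2 : -κ * μ₂ ^ 2 + (1 - κ * f ^ 2) * μ₂ + f ^ 2 / 2 - κ * f ^ 4 / 4 = 0)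
    (h3 : -κ * μ₃ ^ 2 + (1 - κ * f ^ 2) * μ₃ + f ^ 2 / 2 - κ * f ^ 4 / 4 = 0) :
    (κ * f ^ 2 = 1 ∧
      ({μ₁, μ₂, μ₃} : Multiset ℝ) = {-1 / (2 * κ), -1 / (2 * κ), 1 / (2 * κ)}) ∨
    (κ * f ^ 2 = 2 ∧
      ({μ₁, μ₂, μ₃} : Multiset ℝ) = {0, 0, -1 / κ}) ∨
    (κ * f ^ 2 = 3 ∧
      μ₁ = -1 / (2 * κ) ∧ μ₂ = -1 / (2 * κ) ∧ μ₃ = -1 / (2 * κ)) := by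
  have hκ0 : κ ≠ 0 := hκ.ne'
  have hone {a b c : ℝ} (hs : a + b + c = -f ^ 2 / 2) (ha : a = -f ^ 2 / 2)
      (hb : b = -f ^ 2 / 2) (hc : c = 1 / κ - f ^ 2 / 2) :
      κ * f ^ 2 = 1 ∧
        ({a, b, c} : Multiset ℝ) = {-1 / (2 * κ), -1 / (2 * κ), 1 / (2 * κ)} := by
    have hff : f ^ 2 = 1 / κ := by linear_combination -hs + ha + hb + hc
    have haκ : a = -1 / (2 * κ) := by rw [ha, hff]; ring
    have hbκ : b = -1 / (2 * κ) := by rw [hb, hff]; ring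
    have hcκ : c = 1 / (2 * κ) := by rw [hc, hff]; ring
    exact ⟨by rw [hff]; field_simp, by rw [haκ, hbκ, hcκ]⟩
  have htwo {a b c : ℝ} (hs : a + b + c = -f ^ 2 / 2) (ha : a = 1 / κ - f ^ 2 / 2)
      (hb : b = 1 / κ - f ^ 2 / 2) (hc : c = -f ^ 2 / 2) :
      κ * f ^ 2 = 2 ∧ ({a, b, c} : Multiset ℝ) = {0, 0, -1 / κ} := by
    have hff : f ^ 2 = 2 / κ := by linear_combination -hs + ha + hb + hc
    have ha0 : a = 0 := by rw [ha, hff]; ring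
    have hb0 : b = 0 := by rw [hb, hff]; ring
    have hcκ : c = -1 / κ := by rw [hc, hff]; ring
    exact ⟨by rw [hff]; field_simp, by rw [ha0, hb0, hcκ]⟩
  rcases principal_curvature_eq_or_eq hκ0 h1 with e1 | e1 <;>
    rcases principal_curvature_eq_or_eq hκ0 h2 with e2 | e2 <;>
    rcases principal_curvature_eq_or_eq hκ0 h3 with e3 | e3
  · exact absurd (by linarith : f ^ 2 = 0) (pow_ne_zero 2 hf)
  · exact Or.inl (hone hsum e1 e2 e3)
  · rw [Multiset.triple_swap_right μ₁]
    exact Or.inl (hone (by linarith) e1 e3 e2)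
  · rw [Multiset.triple_swap_left μ₁, Multiset.triple_swap_right μ₂]
    exact Or.inr (Or.inl (htwo (by linarith) e2 e3 e1))
  · rw [Multiset.triple_swap_left μ₁, Multiset.triple_swap_right μ₂]
    exact Or.inl (hone (by linarith) e2 e3 e1)
  · rw [Multiset.triple_swap_right μ₁]
    exact Or.inr (Or.inl (htwo (by linarith) e1 e3 e2))
  · exact Or.inr (Or.inl (htwo hsum e1 e2 e3))
  · have hff : f ^ 2 = 3 / κ := by linear_combination -hsum + e1 + e2 + e3
    have hval : 1 / κ - f ^ 2 / 2 = -1 / (2 * κ) := by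
      rw [hff]
      field_simp
      norm_num
    exact Or.inr (Or.inr ⟨by rw [hff]; field_simp, e1.trans hval, e2.trans hval, e3.trans hval⟩)
end

section
/- Fix real numbers κ > 0 and s. Define α : (0, ∞) → ℝ by α(t) = (−2s·t² + (3/2)κs·t⁴ − (1/2)κs²·t² + 5t⁴ − (9/8)κ·t⁶)/(3κt² + 2), and define B : (0, ∞) → ℝ by B(t) = s/3 − (κ/6)s·t² + (κ/18)s² + (κ/2)·α(t) − t²/2 + (κ/8)t⁴ + α'(t)/(2t) − α(t)/t², where α' denotes the derivative of α. Then B(t)/t⁴ tends to −κ/16 as t → +∞; in particular, there exists T > 0 such that B(t) < 0 for all t ≥ T, so B is not identically zero on (0, ∞). -/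
/-- The function `α` arising in the proof that Einstein three-dimensional Heterotic
solitons have constant dilaton:
`α(t) = (−2st² + (3/2)κst⁴ − (1/2)κs²t² + 5t⁴ − (9/8)κt⁶)/(3κt² + 2)`. -/
noncomputable def alphaFun (κ s t : ℝ) : ℝ :=
  (-2 * s * t ^ 2 + 3 / 2 * κ * s * t ^ 4 - 1 / 2 * κ * s ^ 2 * t ^ 2 + 5 * t ^ 4
      - 9 / 8 * κ * t ^ 6) / (3 * κ * t ^ 2 + 2)

/-- The function `B` whose vanishing on the image of the dilaton forces it to be constant:
`B(t) = s/3 − (κ/6)st² + (κ/18)s² + (κ/2)α(t) − t²/2 + (κ/8)t⁴ + α'(t)/(2t) − α(t)/t²`. -/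
noncomputable def BFun (κ s t : ℝ) : ℝ :=
  s / 3 - κ / 6 * s * t ^ 2 + κ / 18 * s ^ 2 + κ / 2 * alphaFun κ s t - t ^ 2 / 2
    + κ / 8 * t ^ 4 + deriv (alphaFun κ s) t / (2 * t) - alphaFun κ s t / t ^ 2

theorem hasDerivAt_alphaFun {κ : ℝ} (hκ : 0 < κ) (s t : ℝ) :
    HasDerivAt (alphaFun κ s)
      (((-4 * s * t + 6 * κ * s * t ^ 3 - κ * s ^ 2 * t + 20 * t ^ 3 - 27 / 4 * κ * t ^ 5)
          * (3 * κ * t ^ 2 + 2)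
        - (-2 * s * t ^ 2 + 3 / 2 * κ * s * t ^ 4 - 1 / 2 * κ * s ^ 2 * t ^ 2 + 5 * t ^ 4
          - 9 / 8 * κ * t ^ 6) * (6 * κ * t)) / (3 * κ * t ^ 2 + 2) ^ 2) t := by
  have hden : 3 * κ * t ^ 2 + 2 ≠ 0 := by positivity
  have hpow (c : ℝ) (n : ℕ) : HasDerivAt (fun x : ℝ => c * x ^ n) (c * (n * t ^ (n - 1))) t :=
    (hasDerivAt_pow n t).const_mul c
  have hnum := ((((hpow (-2 * s) 2).add (hpow (3 / 2 * κ * s) 4)).sub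
    (hpow (1 / 2 * κ * s ^ 2) 2)).add (hpow 5 4)).sub (hpow (9 / 8 * κ) 6)
  refine (hnum.div ((hpow (3 * κ) 2).add_const 2) hden).congr_deriv ?_
  simp only [Pi.add_apply, Pi.sub_apply]
  push_cast
  ring

/-- The function `u ↦ u⁴ B(1/u)`, written in a form regular at `u = 0`. -/
noncomputable def BFunAtInfinity (κ s u : ℝ) : ℝ :=
  s / 3 * u ^ 4 - κ / 6 * s * u ^ 2 + κ / 18 * s ^ 2 * u ^ 4 - u ^ 2 / 2 + κ / 8
  + (κ / 2 - u ^ 2) * ((-2 * s * u ^ 4 + 3 / 2 * κ * s * u ^ 2 - 1 / 2 * κ * s ^ 2 * u ^ 4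
      + 5 * u ^ 2 - 9 / 8 * κ) / (3 * κ + 2 * u ^ 2))
  + u ^ 2 / 2 *
    (((-4 * s * u ^ 4 + 6 * κ * s * u ^ 2 - κ * s ^ 2 * u ^ 4 + 20 * u ^ 2 - 27 / 4 * κ)
        * (3 * κ + 2 * u ^ 2)
      - (-2 * s * u ^ 4 + 3 / 2 * κ * s * u ^ 2 - 1 / 2 * κ * s ^ 2 * u ^ 4
        + 5 * u ^ 2 - 9 / 8 * κ) * (6 * κ)) / (3 * κ + 2 * u ^ 2) ^ 2)

theorem continuous_BFunAtInfinity {κ : ℝ} (hκ : 0 < κ) (s : ℝ) :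
    Continuous (BFunAtInfinity κ s) := by
  unfold BFunAtInfinity
  fun_prop (disch := intro u; positivity)

theorem BFunAtInfinity_zero {κ : ℝ} (hκ : 0 < κ) (s : ℝ) :
    BFunAtInfinity κ s 0 = -κ / 16 := by
  unfold BFunAtInfinity
  field_simp
  ring

theorem BFun_div_pow_four {κ : ℝ} (hκ : 0 < κ) (s : ℝ) {t : ℝ} (ht : 0 < t) :
    BFun κ s t / t ^ 4 = BFunAtInfinity κ s t⁻¹ := by
  have hden : 3 * κ * t ^ 2 + 2 ≠ 0 := by positivity
  have hden_inv : 3 * κ + 2 * t⁻¹ ^ 2 = (3 * κ * t ^ 2 + 2) / t ^ 2 := by field_simp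
  simp only [BFun, BFunAtInfinity, (hasDerivAt_alphaFun hκ s t).deriv, hden_inv]
  unfold alphaFun
  generalize 3 * κ * t ^ 2 + 2 = d at hden ⊢
  field_simp
  ring

theorem tendsto_BFun_div_pow_four {κ : ℝ} (hκ : 0 < κ) (s : ℝ) :
    Filter.Tendsto (fun t => BFun κ s t / t ^ 4) Filter.atTop (nhds (-κ / 16)) := by
  have hlim : Filter.Tendsto (fun t : ℝ => BFunAtInfinity κ s t⁻¹) Filter.atTop
      (nhds (BFunAtInfinity κ s 0)) :=
    ((continuous_BFunAtInfinity hκ s).tendsto 0).comp tendsto_inv_atTop_zero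
  rw [BFunAtInfinity_zero hκ] at hlim
  refine hlim.congr' ?_
  filter_upwards [Filter.eventually_gt_atTop 0] with t ht
  exact (BFun_div_pow_four hκ s ht).symm

/-- Analytic core of the constancy of the dilaton for Einstein three-dimensional Heterotic
solitons: `B(t)/t⁴ → −κ/16` as `t → +∞`; in particular `B(t) < 0` for all large `t`, so `B`
is not identically zero on `(0,∞)`. -/
theorem B_eventually_negative (κ s : ℝ) (hκ : 0 < κ) :
    Filter.Tendsto (fun t => BFun κ s t / t ^ 4) Filter.atTop (nhds (-κ / 16)) ∧
    (∃ T : ℝ, 0 < T ∧ ∀ t ≥ T, BFun κ s t < 0) ∧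
    ¬(∀ t ∈ Set.Ioi (0 : ℝ), BFun κ s t = 0) := by
  have hlim := tendsto_BFun_div_pow_four hκ s
  have hneg : ∃ T : ℝ, 0 < T ∧ ∀ t ≥ T, BFun κ s t < 0 := by
    obtain ⟨T, hT⟩ := Filter.eventually_atTop.1
      (hlim.eventually_lt_const (show -κ / 16 < 0 by linarith))
    refine ⟨max T 1, by positivity, fun t ht => ?_⟩
    have ht_pos : 0 < t := one_pos.trans_le ((le_max_right T 1).trans ht)
    have hdiv := hT t ((le_max_left T 1).trans ht)
    rwa [div_lt_iff₀ (by positivity), zero_mul] at hdiv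
  refine ⟨hlim, hneg, fun hzero => ?_⟩
  obtain ⟨T, hT_pos, hT⟩ := hneg
  exact (hT T le_rfl).ne (hzero T hT_pos)
end

section
/- Let A be a symmetric 3×3 real matrix, s := tr A, let w ∈ ℝ³, and let c ∈ ℝ. With δ the Kronecker delta and ε the Levi-Civita symbol on Fin 3 (ε i j k equals the sign of the permutation (i,j,k) when i, j, k are pairwise distinct and 0 otherwise), define T : Fin 3 → Fin 3 → Fin 3 → Fin 3 → ℝ by T i j k l = δ_{ik}A_{jl} − δ_{il}A_{jk} + δ_{jl}A_{ik} − δ_{jk}A_{il} − (s/2)(δ_{ik}δ_{jl} − δ_{il}δ_{jk}) − (1/2)(w_i·ε_{jkl} − w_j·ε_{ikl}) − (c²/4)(δ_{ik}δ_{jl} − δ_{il}δ_{jk}). Then (1/4)·Σ_{i,j,k,l} (T i j k l)² = Σ_{i,j}(A_{ij})² − s²/4 − c²s/4 + (Σ_i w_i²)/2 + 3c⁴/16. -/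
/-- The Levi-Civita symbol on `Fin 3`: the sign of the permutation `(i,j,k)` of `(0,1,2)`
when `i, j, k` are pairwise distinct, and `0` otherwise. -/
def levicivita (i j k : Fin 3) : ℝ :=
  if (i, j, k) = (0, 1, 2) ∨ (i, j, k) = (1, 2, 0) ∨ (i, j, k) = (2, 0, 1) then 1
  else if (i, j, k) = (0, 2, 1) ∨ (i, j, k) = (2, 1, 0) ∨ (i, j, k) = (1, 0, 2) then -1
  else 0

/-- Component form of the norm formula
`|R^{g,H}|² = |Ric|² − s²/4 − f²s/4 + |df|²/2 + 3f⁴/16` in dimension three, where the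
curvature tensor `T` of the metric connection with skew torsion `−H = −f·ν_g` is built from
the Ricci matrix `A` (symmetric, trace `s`), the components `w` of `df`, and `c = f`. -/
theorem torsion_curvature_norm_three_dim (A : Matrix (Fin 3) (Fin 3) ℝ) (hA : A.IsSymm)
    (w : Fin 3 → ℝ) (c : ℝ)
    (T : Fin 3 → Fin 3 → Fin 3 → Fin 3 → ℝ)
    (hT : T = fun i j k l =>
      (if i = k then (1 : ℝ) else 0) * A j l - (if i = l then (1 : ℝ) else 0) * A j k
        + (if j = l then (1 : ℝ) else 0) * A i k - (if j = k then (1 : ℝ) else 0) * A i l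
        - A.trace / 2 *
          ((if i = k then (1 : ℝ) else 0) * (if j = l then (1 : ℝ) else 0)
            - (if i = l then (1 : ℝ) else 0) * (if j = k then (1 : ℝ) else 0))
        - 1 / 2 * (w i * levicivita j k l - w j * levicivita i k l)
        - c ^ 2 / 4 *
          ((if i = k then (1 : ℝ) else 0) * (if j = l then (1 : ℝ) else 0)
            - (if i = l then (1 : ℝ) else 0) * (if j = k then (1 : ℝ) else 0))) :
    1 / 4 * ∑ i : Fin 3, ∑ j : Fin 3, ∑ k : Fin 3, ∑ l : Fin 3, (T i j k l) ^ 2 =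
      (∑ i : Fin 3, ∑ j : Fin 3, (A i j) ^ 2) - A.trace ^ 2 / 4 - c ^ 2 * A.trace / 4
        + (∑ i : Fin 3, (w i) ^ 2) / 2 + 3 * c ^ 4 / 16 := by
  have h₁₀ : A 1 0 = A 0 1 := hA.apply 0 1
  have h₂₀ : A 2 0 = A 0 2 := hA.apply 0 2
  have h₂₁ : A 2 1 = A 1 2 := hA.apply 1 2
  subst hT
  simp [Fin.sum_univ_three, Matrix.trace_fin_three, levicivita, h₁₀, h₂₀, h₂₁]
  ring
end
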